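/- Let k ≥ 1 and n ≥ 1 be integers and let m_1, …, m_n ∈ ℤ^k be characters defining a linear action of the torus T = (ℂˣ)^k on ℂ^n by (t · x)_j = t^{m_j} x_j, where t^{m_j} = ∏_{i=1}^{k} t_i^{m_{j,i}}. Let x, y ∈ ℂ^n, suppose y lies in the closure of the orbit T·x = { t·x : t ∈ T }, and suppose the orbit T·y is closed in ℂ^n. Then there exists a one-parameter subgroup of T, i.e. a = (a_1,…,a_k) ∈ ℤ^k with λ_a(s) = (s^{a_1}, …, s^{a_k}) for s ∈ ℂˣ, such that the limit lim_{s→0} λ_a(s)·x exists in ℂ^n and lies in the orbit T·y. -/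

import Mathlib

open scoped BigOperators
open Filter

/-- The linear action of the torus `T = (ℂˣ)^k` on `ℂ^n` given by characters
`m_1, …, m_n ∈ ℤ^k`: `(t · x)_j = (∏ i, t_i ^ m_{j,i}) · x_j`. -/
noncomputable def torusSmul {k n : ℕ} (m : Fin n → Fin k → ℤ) (t : Fin k → ℂˣ)
    (x : Fin n → ℂ) : Fin n → ℂ :=
  fun j => (∏ i, ((t i : ℂˣ) ^ m j i : ℂˣ) : ℂ) * x j

/-- The orbit `T · x` of `x ∈ ℂ^n` under the torus action with characters `m`. -/
noncomputable def torusOrbit {k n : ℕ} (m : Fin n → Fin k → ℤ) (x : Fin n → ℂ) :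
    Set (Fin n → ℂ) :=
  {y | ∃ t : Fin k → ℂˣ, y = torusSmul m t x}

/-- If the entries of a sequence of integer vectors are bounded for indices in `p` and tend to
`+∞` for indices in `q`, then some difference of two members of the sequence vanishes on `p` and
is positive on `q`. -/
theorem exists_sub_eq_zero_and_pos {ι : Type*} [Finite ι] (p q : ι → Prop) (f : ℕ → ι → ℤ) (C : ℤ)
    (hp : ∀ N j, p j → |f N j| ≤ C) (hq : ∀ (N : ℕ) j, q j → (N : ℤ) ≤ f N j) :
    ∃ M N : ℕ, (∀ j, p j → f M j - f N j = 0) ∧ ∀ j, q j → 0 < f M j - f N j := by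
  let g : ℕ → {j // p j} → Set.Icc (-C) C := fun N j => ⟨f N j, abs_le.mp (hp N j j.2)⟩
  obtain ⟨v, hv⟩ := Finite.exists_infinite_fiber g
  rw [Set.infinite_coe_iff] at hv
  obtain ⟨N, hN⟩ := hv.nonempty
  obtain ⟨B, hB⟩ := (Set.finite_range (f N)).bddAbove
  obtain ⟨M, hM, hBM⟩ := hv.exists_gt B.toNat
  refine ⟨M, N, fun j hj => ?_, fun j hj => ?_⟩
  · have h : g M = g N := Eq.trans hM (Eq.symm hN)
    exact sub_eq_zero.mpr (congrArg Subtype.val (congrFun h ⟨j, hj⟩))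
  · have h₁ : f N j ≤ B := hB ⟨j, rfl⟩
    have h₂ := hq M j hj
    omega

theorem torusSmul_zpow_apply {k n : ℕ} (m : Fin n → Fin k → ℤ) (a : Fin k → ℤ) (s : ℂˣ)
    (x : Fin n → ℂ) (j : Fin n) :
    torusSmul m (fun i => s ^ a i) x j = (s : ℂ) ^ (∑ i, m j i * a i) * x j := by
  have h : ∏ i, (s ^ a i) ^ m j i = s ^ (∑ i, m j i * a i) := by
    simp_rw [← zpow_mul, mul_comm (a _)]
    exact (map_sum (zmultiplesHom _ (Additive.ofMul s)) _ _).symm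
  rw [← Units.val_zpow_eq_zpow_val, ← h]
  simp [torusSmul]

/-- If `λ_a` has weight zero on the coordinates in `p` and positive weight on the other
coordinates of `x`, then `λ_a(s) · x` tends to the restriction of `x` to `p` as `s → 0`. -/
theorem tendsto_torusSmul_zpow {k n : ℕ} (m : Fin n → Fin k → ℤ) (a : Fin k → ℤ)
    (x : Fin n → ℂ) (p : Fin n → Prop) [DecidablePred p]
    (hp : ∀ j, p j → ∑ i, m j i * a i = 0)
    (hq : ∀ j, x j ≠ 0 → ¬ p j → 0 < ∑ i, m j i * a i) :
    Tendsto (fun s : ℂˣ => torusSmul m (fun i => s ^ a i) x)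
      (comap (Units.val : ℂˣ → ℂ) (nhds 0)) (nhds fun j => if p j then x j else 0) := by
  rw [tendsto_pi_nhds]
  intro j
  simp_rw [torusSmul_zpow_apply]
  by_cases hj : p j
  · simpa [hj, hp j hj] using tendsto_const_nhds
  by_cases hx : x j = 0
  · simpa [hx] using tendsto_const_nhds
  obtain ⟨d, hd⟩ := Int.eq_ofNat_of_zero_le (hq j hx hj).le
  have hd0 : d ≠ 0 := by have := hq j hx hj; omega
  have h : Tendsto (fun z : ℂ => z ^ d * x j) (nhds 0) (nhds 0) := by
    have : Continuous fun z : ℂ => z ^ d * x j := by fun_prop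
    simpa [hd0] using this.tendsto 0
  simpa [hj, hd, Function.comp_def] using h.comp tendsto_comap

theorem log_norm_torusSmul {k n : ℕ} (m : Fin n → Fin k → ℤ) (t : Fin k → ℂˣ)
    (x : Fin n → ℂ) (j : Fin n) (hx : x j ≠ 0) :
    Real.log ‖torusSmul m t x j‖ = ∑ i, m j i * Real.log ‖(t i : ℂ)‖ + Real.log ‖x j‖ := by
  have ht (i : Fin k) : ‖((t i ^ m j i : ℂˣ) : ℂ)‖ ≠ 0 := norm_ne_zero_iff.mpr (Units.ne_zero _)
  rw [torusSmul, norm_mul, Real.log_mul _ (norm_ne_zero_iff.mpr hx), norm_prod,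
    Real.log_prod fun i _ => ht i]
  · simp [Real.log_zpow]
  · rw [norm_prod]
    exact Finset.prod_ne_zero_iff.mpr fun i _ => ht i

theorem abs_sum_mul_floor_sub_le {k : ℕ} (c : Fin k → ℤ) (u : Fin k → ℝ) :
    |((∑ i, c i * ⌊u i⌋ : ℤ) : ℝ) - ∑ i, c i * u i| ≤ ∑ i, |(c i : ℝ)| := by
  push_cast
  rw [← Finset.sum_sub_distrib]
  refine (Finset.abs_sum_le_sum_abs _ _).trans (Finset.sum_le_sum fun i _ => ?_)
  rw [← mul_sub, abs_mul]
  refine mul_le_of_le_one_right (abs_nonneg _) (abs_le.mpr ⟨?_, ?_⟩)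
  · linarith [Int.lt_floor_add_one (u i)]
  · linarith [Int.floor_le (u i)]

theorem ne_zero_of_mem_closure_torusOrbit {k n : ℕ} {m : Fin n → Fin k → ℤ} {x y : Fin n → ℂ}
    (hy : y ∈ closure (torusOrbit m x)) {j : Fin n} (hj : y j ≠ 0) : x j ≠ 0 := by
  obtain ⟨w, ⟨t, rfl⟩, hw⟩ := ((mem_closure_iff_frequently.mp hy).and_eventually
    ((continuous_apply j).continuousAt.eventually_ne hj)).exists
  exact right_ne_zero_of_mul hw

/-- If `y` lies in the closure of the orbit of `x`, there are one-parameter subgroups whose weights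
are uniformly bounded on the support of `y` and arbitrarily large on the rest of the support
of `x`. -/
theorem exists_bounded_weights {k n : ℕ} {m : Fin n → Fin k → ℤ} {x y : Fin n → ℂ}
    (hy : y ∈ closure (torusOrbit m x)) :
    ∃ C : ℤ, ∀ N : ℕ, ∃ b : Fin k → ℤ, ∀ j,
      (y j ≠ 0 → |∑ i, m j i * b i| ≤ C) ∧
      (x j ≠ 0 ∧ y j = 0 → (N : ℤ) ≤ ∑ i, m j i * b i) := by
  obtain ⟨B, hB⟩ := (Set.finite_range fun j =>
    |Real.log ‖y j‖| + |Real.log ‖x j‖| + ∑ i, |(m j i : ℝ)| + 1).bddAbove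
  refine ⟨⌈B⌉, fun N => ?_⟩
  have hev : ∀ᶠ w in nhds y, ∀ j, (y j ≠ 0 → |Real.log ‖w j‖ - Real.log ‖y j‖| < 1) ∧
      (y j = 0 → ‖w j‖ < Real.exp (-(N + B))) := by
    refine eventually_all.mpr fun j => ?_
    by_cases hj : y j = 0
    · have h : ContinuousAt (fun w : Fin n → ℂ => ‖w j‖) y :=
        (continuous_apply j).norm.continuousAt
      filter_upwards [h.eventually_lt_const (u := Real.exp (-(N + B)))
        (by simpa [hj] using Real.exp_pos _)] with w hw
      exact ⟨fun h => absurd hj h, fun _ => hw⟩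
    · have h : ContinuousAt (fun w : Fin n → ℂ => |Real.log ‖w j‖ - Real.log ‖y j‖|) y := by
        have : ContinuousAt (fun w : Fin n → ℂ => Real.log ‖w j‖) y :=
          (continuous_apply j).norm.continuousAt.log (norm_ne_zero_iff.mpr hj)
        fun_prop
      filter_upwards [h.eventually_lt_const (show _ < (1 : ℝ) by simp)] with w hw
      exact ⟨fun _ => hw, fun h => absurd h hj⟩
  obtain ⟨w, ⟨t, rfl⟩, hw⟩ := ((mem_closure_iff_frequently.mp hy).and_eventually hev).exists
  refine ⟨fun i => ⌊-Real.log ‖(t i : ℂ)‖⌋, fun j => ?_⟩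
  have hfl := abs_le.mp (abs_sum_mul_floor_sub_le (m j) fun i => -Real.log ‖(t i : ℂ)‖)
  simp only [mul_neg, Finset.sum_neg_distrib] at hfl
  have hBj : _ ≤ B := hB ⟨j, rfl⟩
  dsimp only at hBj
  have hlx := abs_le.mp (le_refl |Real.log ‖x j‖|)
  have hly := abs_le.mp (le_refl |Real.log ‖y j‖|)
  constructor
  · intro hj
    have hlog := log_norm_torusSmul m t x j (ne_zero_of_mem_closure_torusOrbit hy hj)
    have hwj := abs_lt.mp ((hw j).1 hj)
    rw [← Int.cast_le (R := ℝ), Int.cast_abs]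
    refine le_trans (abs_le.mpr ⟨?_, ?_⟩) (Int.le_ceil B) <;> linarith
  · rintro ⟨hx, hj⟩
    have hlog := log_norm_torusSmul m t x j hx
    have hne : torusSmul m t x j ≠ 0 :=
      mul_ne_zero (Finset.prod_ne_zero_iff.mpr fun i _ => Units.ne_zero _) hx
    have hwj := (Real.log_lt_iff_lt_exp (norm_pos_iff.mpr hne)).mpr ((hw j).2 hj)
    rw [← Int.cast_le (R := ℝ), Int.cast_natCast]
    linarith [abs_nonneg (Real.log ‖y j‖)]

/-- If `y` lies in the closure of the orbit of `x`, then the restriction of `x` to the support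
of `y` lies in the closure of the orbit of `y`. -/
theorem restrict_mem_closure_torusOrbit {k n : ℕ} {m : Fin n → Fin k → ℤ} {x y : Fin n → ℂ}
    [DecidablePred fun j => y j ≠ 0] (hy : y ∈ closure (torusOrbit m x)) :
    (fun j => if y j ≠ 0 then x j else 0) ∈ closure (torusOrbit m y) := by
  have hc : ContinuousAt (fun (w : Fin n → ℂ) j => x j * y j / w j) y := by
    refine continuousAt_pi.mpr fun j => ?_
    by_cases hj : y j = 0
    · simpa [hj] using continuousAt_const
    · exact continuousAt_const.div (continuous_apply j).continuousAt hj
  have heq : (fun j => if y j ≠ 0 then x j else 0) = fun j => x j * y j / y j := by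
    funext j
    by_cases hj : y j = 0 <;> simp [hj]
  rw [heq]
  refine closure_mono ?_ (hc.continuousWithinAt.mem_closure_image hy)
  rintro _ ⟨_, ⟨t, rfl⟩, rfl⟩
  refine ⟨fun i => (t i)⁻¹, funext fun j => ?_⟩
  by_cases hj : y j = 0
  · simp [torusSmul, hj]
  · have hx := ne_zero_of_mem_closure_torusOrbit hy hj
    simp only [torusSmul, inv_zpow, Units.val_inv_eq_inv_val, Finset.prod_inv_distrib]
    field_simp


/-- Richardson's lemma for torus actions: if `y` lies in the closure of the torus orbit of
`x` and the orbit of `y` is closed, then there is a one-parameter subgroup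
`λ_a : s ↦ (s^{a_1}, …, s^{a_k})` of the torus such that `lim_{s → 0} λ_a(s) · x` exists
and lies in the orbit of `y`. -/
theorem richardson_torus (k n : ℕ) (hk : 1 ≤ k) (hn : 1 ≤ n)
    (m : Fin n → Fin k → ℤ) (x y : Fin n → ℂ)
    (hy : y ∈ closure (torusOrbit m x)) (hcl : IsClosed (torusOrbit m y)) :
    ∃ (a : Fin k → ℤ) (L : Fin n → ℂ),
      Tendsto (fun s : ℂˣ => torusSmul m (fun i => s ^ a i) x)
        (Filter.comap (Units.val : ℂˣ → ℂ) (nhds 0)) (nhds L) ∧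
      L ∈ torusOrbit m y := by
  classical
  obtain ⟨C, hC⟩ := exists_bounded_weights hy
  choose b hb using hC
  obtain ⟨M, N, h₀, hpos⟩ := exists_sub_eq_zero_and_pos (fun j => y j ≠ 0)
    (fun j => x j ≠ 0 ∧ y j = 0) (fun N j => ∑ i, m j i * b N i) C
    (fun N j => (hb N j).1) (fun N j => (hb N j).2)
  have hsum (j : Fin n) : ∑ i, m j i * (b M i - b N i) =
      ∑ i, m j i * b M i - ∑ i, m j i * b N i := by
    simp_rw [mul_sub, Finset.sum_sub_distrib]
  refine ⟨fun i => b M i - b N i, fun j => if y j ≠ 0 then x j else 0,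
    tendsto_torusSmul_zpow m _ x (fun j => y j ≠ 0) (fun j hj => ?_) fun j hx hj => ?_, ?_⟩
  · exact (hsum j).trans (h₀ j hj)
  · exact (hpos j ⟨hx, not_not.mp hj⟩).trans_eq (hsum j).symm
  · exact hcl.closure_eq ▸ restrict_mem_closure_torusOrbit hy
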